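/- A spectral space X is Noetherian if and only if inv(Y) = gen(Y) for every subset Y of X. (Equivalently, it suffices that inv(Y) = gen(Y) for every open subset Y of X.) -/

import Mathlib

open TopologicalSpace Set

/-- A topological space is *spectral* if it is quasicompact, `T0`, quasi-sober (every nonempty
irreducible closed subset has a generic point), its quasicompact open subsets are closed under
finite intersections (quasi-separatedness) and form a basis for the topology. -/
def IsSpectralTop (X : Type*) [TopologicalSpace X] : Prop :=
  CompactSpace X ∧ T0Space X ∧ QuasiSober X ∧ QuasiSeparatedSpace X ∧
    IsTopologicalBasis {U : Set X | IsOpen U ∧ IsCompact U}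

variable {X : Type*} [TopologicalSpace X]

/-- `invC Y` : the intersection of all quasicompact open subsets of `X` containing `Y`. -/
def invC (Y : Set X) : Set X := ⋂₀ {U : Set X | (IsOpen U ∧ IsCompact U) ∧ Y ⊆ U}

/-- `genC Y` : the set of all generalizations of points of `Y`,
i.e. `{x : cl({x}) ∩ Y ≠ ∅}`. -/
def genC (Y : Set X) : Set X := {x : X | (closure {x} ∩ Y).Nonempty}

/-- `patchC Y` : the intersection of all subsets of the form `U₁ ∪ U₂ᶜ` containing `Y`, where
`U₁`, `U₂` are quasicompact open subsets of `X`. -/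
def patchC (Y : Set X) : Set X :=
  ⋂₀ {S : Set X | (∃ U₁ U₂ : Set X, (IsOpen U₁ ∧ IsCompact U₁) ∧ (IsOpen U₂ ∧ IsCompact U₂) ∧
      S = U₁ ∪ U₂ᶜ) ∧ Y ⊆ S}

/-- `ptC Y` : the set of points of `invC Y` that are closed in the subspace topology
of `invC Y`. -/
def ptC (Y : Set X) : Set X :=
  {x : X | ∃ h : x ∈ invC Y, IsClosed ({⟨x, h⟩} : Set ↥(invC Y))}

/-- Generalizations of points of `Y` lie in every open set containing `Y`. -/
theorem genC_subset_of_isOpen {Y U : Set X} (hU : IsOpen U) (hYU : Y ⊆ U) : genC Y ⊆ U := by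
  rintro x ⟨y, hyx, hyY⟩
  exact (specializes_iff_mem_closure.mpr hyx).mem_open hU (hYU hyY)

theorem subset_genC (Y : Set X) : Y ⊆ genC Y :=
  fun x hx => ⟨x, subset_closure rfl, hx⟩

theorem genC_subset_invC (Y : Set X) : genC Y ⊆ invC Y :=
  subset_sInter fun _ hU => genC_subset_of_isOpen hU.1.1 hU.2

theorem IsOpen.genC_eq {Y : Set X} (hY : IsOpen Y) : genC Y = Y :=
  (genC_subset_of_isOpen hY Subset.rfl).antisymm (subset_genC Y)

theorem invC_eq_genC [NoetherianSpace X] (Y : Set X) : invC Y = genC Y := by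
  refine Subset.antisymm (fun x hx => ?_) (genC_subset_invC Y)
  by_contra hxY
  exact hx (closure {x})ᶜ ⟨⟨isClosed_closure.isOpen_compl, NoetherianSpace.isCompact _⟩,
    fun y hyY hyx => hxY ⟨y, hyx, hyY⟩⟩ (subset_closure rfl)

/-- In a spectral space `invC Y` is closed in the constructible topology, hence quasicompact. -/
theorem IsSpectralTop.isCompact_invC (hX : IsSpectralTop X) (Y : Set X) :
    IsCompact (invC Y) := by
  obtain ⟨_, _, _, _, hB⟩ := hX
  have : PrespectralSpace X := ⟨hB⟩
  let f : WithConstructibleTopology X → X := WithTopology.ofTopology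
  have hf : Continuous f := hB.continuous_iff.mpr fun U hU =>
    WithConstructibleTopology.isOpen_iff.mpr (hU.2.isOpen_constructibleTopology_of_isOpen hU.1)
  have hclosed : IsClosed (f ⁻¹' invC Y) := by
    rw [invC, preimage_sInter]
    refine isClosed_biInter fun U hU => ⟨WithConstructibleTopology.isOpen_iff.mpr ?_⟩
    exact IsCompact.isOpen_constructibleTopology_of_isClosed (s := Uᶜ)
      (by simpa using hU.1.2) hU.1.1.isClosed_compl
  rw [← image_preimage_eq (invC Y) (WithTopology.ofTopology_surjective _)]
  exact hclosed.isCompact.image hf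

theorem IsSpectralTop.noetherianSpace (hX : IsSpectralTop X)
    (h : ∀ Y : Set X, IsOpen Y → invC Y = genC Y) : NoetherianSpace X :=
  noetherianSpace_iff_opens X |>.mpr fun U => by
    rw [← U.isOpen.genC_eq, ← h U U.isOpen]
    exact hX.isCompact_invC U

/-- A spectral space `X` is Noetherian iff `inv(Y) = gen(Y)` for every subset `Y` of `X`;
equivalently, iff `inv(Y) = gen(Y)` for every open subset `Y` of `X`. -/
theorem stmt4 (hX : IsSpectralTop X) :
    (NoetherianSpace X ↔ ∀ Y : Set X, invC Y = genC Y) ∧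
      (NoetherianSpace X ↔ ∀ Y : Set X, IsOpen Y → invC Y = genC Y) := by
  exact ⟨⟨fun _ => invC_eq_genC, fun h => hX.noetherianSpace fun Y _ => h Y⟩,
    ⟨fun _ Y _ => invC_eq_genC Y, hX.noetherianSpace⟩⟩
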